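/- Fix an integer k ≥ 1. On the finite set S = (ZMod k) × {(a,b) : a,b ∈ {1,2,3,4}, a ≠ b}, consider the equivalence relation generated by: (i,(a,b)) ~ (i,(b,a)) for all i and a ≠ b; (i,(3,1)) ~ (i,(4,1)), (i,(3,2)) ~ (i,(4,2)), (i,(3,4)) ~ (i,(4,3)) for all i; and (i,(2,1)) ~ (i+1,(1,2)), (i,(2,3)) ~ (i+1,(1,3)), (i,(2,4)) ~ (i+1,(1,4)) for all i ∈ ZMod k. Then the equivalence classes are exactly the following 2k+1 sets: for each i ∈ ZMod k the 2-element set {(i,(3,4)), (i,(4,3))}; for each i ∈ ZMod k the 8-element set {(i+1,(1,3)), (i+1,(3,1)), (i+1,(4,1)), (i+1,(1,4)), (i,(2,4)), (i,(4,2)), (i,(3,2)), (i,(2,3))}; and the 2k-element set {(i,(1,2)), (i,(2,1)) : i ∈ ZMod k}. -/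

import Mathlib

/-- Ordered pairs `(a, b)` of distinct elements of the four-element label set
`{1, 2, 3, 4}` (realised inside `Fin 4`, where the four labels `1, 2, 3, 4` are
pairwise distinct); `(i, (a, b))` stands for the branch point on the line `Lₐ`
over the node `Lₐ ∩ L_b` in the `i`-th tile. -/
abbrev NodeBranch : Type := {p : Fin 4 × Fin 4 // p.1 ≠ p.2}

/-- Convenient constructor for elements of `NodeBranch`. -/
def pr (a b : Fin 4) (h : a ≠ b := by decide) : NodeBranch := ⟨(a, b), h⟩

/-- The generating relation for `k` tiles, all of type `D`, glued in a circle: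
the node relation, the in-tile gluing of `L₃` to `L₄` of type `D`, and the
circle gluing of `L₂` of tile `i` to `L₁` of tile `i + 1`. -/
inductive CircleDGen (k : ℕ) : ZMod k × NodeBranch → ZMod k × NodeBranch → Prop
  | node (i : ZMod k) (a b : Fin 4) (h : a ≠ b) :
      CircleDGen k (i, ⟨(a, b), h⟩) (i, ⟨(b, a), h.symm⟩)
  | tileD₁ (i : ZMod k) : CircleDGen k (i, pr 3 1) (i, pr 4 1)
  | tileD₂ (i : ZMod k) : CircleDGen k (i, pr 3 2) (i, pr 4 2)
  | tileD₃ (i : ZMod k) : CircleDGen k (i, pr 3 4) (i, pr 4 3)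
  | circle₁ (i : ZMod k) : CircleDGen k (i, pr 2 1) (i + 1, pr 1 2)
  | circle₂ (i : ZMod k) : CircleDGen k (i, pr 2 3) (i + 1, pr 1 3)
  | circle₃ (i : ZMod k) : CircleDGen k (i, pr 2 4) (i + 1, pr 1 4)

/-- The label of the class of a branch point. -/
def cuspLabel (k : ℕ) (x : ZMod k × NodeBranch) : Option (ZMod k ⊕ ZMod k) :=
  if x.2 = pr 3 4 ∨ x.2 = pr 4 3 then some (Sum.inl x.1)
  else if x.2 = pr 1 2 ∨ x.2 = pr 2 1 then none
  else if x.2.1.1 = 1 ∨ x.2.1.2 = 1 then some (Sum.inr (x.1 - 1))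
  else some (Sum.inr x.1)

/-- A representative of each class. -/
def cuspRep (k : ℕ) : Option (ZMod k ⊕ ZMod k) → ZMod k × NodeBranch
  | none => (0, pr 1 2)
  | some (Sum.inl i) => (i, pr 3 4)
  | some (Sum.inr i) => (i, pr 2 3)

theorem nodeBranch_cases (p : NodeBranch) :
    p = pr 1 2 ∨ p = pr 2 1 ∨ p = pr 1 3 ∨ p = pr 3 1 ∨ p = pr 1 4 ∨ p = pr 4 1 ∨
    p = pr 2 3 ∨ p = pr 3 2 ∨ p = pr 2 4 ∨ p = pr 4 2 ∨ p = pr 3 4 ∨ p = pr 4 3 := by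
  revert p; decide

section labels
variable (k : ℕ) (i : ZMod k)
theorem lab12 : cuspLabel k (i, pr 1 2) = none := by simp [cuspLabel, pr]
theorem lab21 : cuspLabel k (i, pr 2 1) = none := by simp [cuspLabel, pr]
theorem lab13 : cuspLabel k (i, pr 1 3) = some (Sum.inr (i - 1)) := by simp [cuspLabel, pr]
theorem lab31 : cuspLabel k (i, pr 3 1) = some (Sum.inr (i - 1)) := by simp [cuspLabel, pr]
theorem lab14 : cuspLabel k (i, pr 1 4) = some (Sum.inr (i - 1)) := by simp [cuspLabel, pr]
theorem lab41 : cuspLabel k (i, pr 4 1) = some (Sum.inr (i - 1)) := by simp [cuspLabel, pr]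
theorem lab23 : cuspLabel k (i, pr 2 3) = some (Sum.inr i) := by simp [cuspLabel, pr]
theorem lab32 : cuspLabel k (i, pr 3 2) = some (Sum.inr i) := by simp [cuspLabel, pr]
theorem lab24 : cuspLabel k (i, pr 2 4) = some (Sum.inr i) := by simp [cuspLabel, pr]
theorem lab42 : cuspLabel k (i, pr 4 2) = some (Sum.inr i) := by simp [cuspLabel, pr]
theorem lab34 : cuspLabel k (i, pr 3 4) = some (Sum.inl i) := by simp [cuspLabel, pr]
theorem lab43 : cuspLabel k (i, pr 4 3) = some (Sum.inl i) := by simp [cuspLabel, pr]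
end labels

theorem cuspLabel_rep (k : ℕ) (t : Option (ZMod k ⊕ ZMod k)) :
    cuspLabel k (cuspRep k t) = t := by
  rcases t with _ | i | i
  · exact lab12 k 0
  · exact lab34 k i
  · exact lab23 k i

theorem cuspLabel_gen (k : ℕ) {x y : ZMod k × NodeBranch} (h : CircleDGen k x y) :
    cuspLabel k x = cuspLabel k y := by
  cases h with
  | node i a b h =>
    have hp := nodeBranch_cases ⟨(a, b), h⟩
    rcases hp with hp | hp | hp | hp | hp | hp | hp | hp | hp | hp | hp | hp <;>
    · simp only [pr, Subtype.mk.injEq, Prod.mk.injEq] at hp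
      obtain ⟨rfl, rfl⟩ := hp
      simp [cuspLabel, pr]
  | tileD₁ i => rw [lab31, lab41]
  | tileD₂ i => rw [lab32, lab42]
  | tileD₃ i => rw [lab34, lab43]
  | circle₁ i => rw [lab21, lab12]
  | circle₂ i => rw [lab23, lab13, add_sub_cancel_right]
  | circle₃ i => rw [lab24, lab14, add_sub_cancel_right]

theorem eqv_swap (k : ℕ) (i : ZMod k) (a b : Fin 4) (h : a ≠ b) (h' : b ≠ a) :
    Relation.EqvGen (CircleDGen k) (i, pr a b h) (i, pr b a h') :=
  .rel _ _ (.node i a b h)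

theorem eqv_rep12 (k : ℕ) (hk : 1 ≤ k) (i : ZMod k) :
    Relation.EqvGen (CircleDGen k) (i, pr 1 2) (0, pr 1 2) := by
  have : NeZero k := ⟨by omega⟩
  have key : ∀ n : ℕ, Relation.EqvGen (CircleDGen k) ((n : ZMod k), pr 1 2) (0, pr 1 2) := by
    intro n
    induction n with
    | zero => rw [Nat.cast_zero]; exact .refl _
    | succ n ih =>
      rw [Nat.cast_succ]
      exact .trans _ _ _ (.symm _ _ (.rel _ _ (.circle₁ (n : ZMod k))))
        (.trans _ _ _ (eqv_swap k _ 2 1 _ _) ih)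
  have := key i.val
  rwa [ZMod.natCast_zmod_val] at this

theorem eqv_rep (k : ℕ) (hk : 1 ≤ k) (x : ZMod k × NodeBranch) :
    Relation.EqvGen (CircleDGen k) x (cuspRep k (cuspLabel k x)) := by
  obtain ⟨i, p⟩ := x
  have e32 : ∀ j : ZMod k, Relation.EqvGen (CircleDGen k) (j, pr 3 2) (j, pr 2 3) :=
    fun j => eqv_swap k j 3 2 _ _
  have e42 : ∀ j : ZMod k, Relation.EqvGen (CircleDGen k) (j, pr 4 2) (j, pr 2 3) :=
    fun j => .trans _ _ _ (.symm _ _ (.rel _ _ (.tileD₂ j))) (e32 j)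
  have e24 : ∀ j : ZMod k, Relation.EqvGen (CircleDGen k) (j, pr 2 4) (j, pr 2 3) :=
    fun j => .trans _ _ _ (eqv_swap k j 2 4 _ _) (e42 j)
  have e13 : Relation.EqvGen (CircleDGen k) (i, pr 1 3) (i - 1, pr 2 3) := by
    have := Relation.EqvGen.rel _ _ (CircleDGen.circle₂ (i - 1))
    rw [sub_add_cancel] at this
    exact .symm _ _ this
  have e14 : Relation.EqvGen (CircleDGen k) (i, pr 1 4) (i - 1, pr 2 3) := by
    have := Relation.EqvGen.rel _ _ (CircleDGen.circle₃ (i - 1))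
    rw [sub_add_cancel] at this
    exact .trans _ _ _ (.symm _ _ this) (e24 _)
  rcases nodeBranch_cases p with
    rfl | rfl | rfl | rfl | rfl | rfl | rfl | rfl | rfl | rfl | rfl | rfl
  · rw [lab12]; exact eqv_rep12 k hk i
  · rw [lab21]; exact .trans _ _ _ (eqv_swap k i 2 1 _ _) (eqv_rep12 k hk i)
  · rw [lab13]; exact e13
  · rw [lab31]; exact .trans _ _ _ (eqv_swap k i 3 1 _ _) e13
  · rw [lab14]; exact e14
  · rw [lab41]; exact .trans _ _ _ (eqv_swap k i 4 1 _ _) e14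
  · rw [lab23]; exact .refl _
  · rw [lab32]; exact e32 i
  · rw [lab24]; exact e24 i
  · rw [lab42]; exact e42 i
  · rw [lab34]; exact .refl _
  · rw [lab43]; exact eqv_swap k i 4 3 _ _

theorem eqv_iff (k : ℕ) (hk : 1 ≤ k) (x y : ZMod k × NodeBranch) :
    Relation.EqvGen (CircleDGen k) x y ↔ cuspLabel k x = cuspLabel k y := by
  constructor
  · intro h
    induction h with
    | rel _ _ h => exact cuspLabel_gen k h
    | refl _ => rfl
    | symm _ _ _ ih => exact ih.symm
    | trans _ _ _ _ _ ih₁ ih₂ => exact ih₁.trans ih₂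
  · intro h
    have h2 := eqv_rep k hk y
    rw [← h] at h2
    exact .trans _ _ _ (eqv_rep k hk x) (.symm _ _ h2)

/-- The fibre of the label map. -/
def cuspFib (k : ℕ) (t : Option (ZMod k ⊕ ZMod k)) : Set (ZMod k × NodeBranch) :=
  {x | cuspLabel k x = t}

theorem classes_eq (k : ℕ) (hk : 1 ≤ k) :
    (Relation.EqvGen.setoid (CircleDGen k)).classes = Set.range (cuspFib k) := by
  ext s
  constructor
  · rintro ⟨y, rfl⟩
    refine ⟨cuspLabel k y, ?_⟩
    ext x
    exact (eqv_iff k hk x y).symm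
  · rintro ⟨t, rfl⟩
    refine ⟨cuspRep k t, ?_⟩
    ext x
    refine Iff.trans ?_ (eqv_iff k hk x (cuspRep k t)).symm
    rw [cuspLabel_rep]; rfl

theorem cuspFib_injective (k : ℕ) : Function.Injective (cuspFib k) := by
  intro s t h
  have : cuspRep k s ∈ cuspFib k t := h ▸ cuspLabel_rep k s
  exact (cuspLabel_rep k s).symm.trans this

theorem cuspFib_inl (k : ℕ) (i : ZMod k) :
    cuspFib k (some (Sum.inl i)) = {(i, pr 3 4), (i, pr 4 3)} := by
  ext ⟨j, p⟩
  change cuspLabel k (j, p) = _ ↔ _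
  rcases nodeBranch_cases p with
    rfl | rfl | rfl | rfl | rfl | rfl | rfl | rfl | rfl | rfl | rfl | rfl <;>
  simp only [lab12, lab21, lab13, lab31, lab14, lab41, lab23, lab32, lab24, lab42, lab34, lab43] <;>
  simp [pr]

theorem cuspFib_inr (k : ℕ) (i : ZMod k) :
    cuspFib k (some (Sum.inr i)) =
      {(i + 1, pr 1 3), (i + 1, pr 3 1), (i + 1, pr 4 1), (i + 1, pr 1 4),
          (i, pr 2 4), (i, pr 4 2), (i, pr 3 2), (i, pr 2 3)} := by
  ext ⟨j, p⟩
  change cuspLabel k (j, p) = _ ↔ _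
  rcases nodeBranch_cases p with
    rfl | rfl | rfl | rfl | rfl | rfl | rfl | rfl | rfl | rfl | rfl | rfl <;>
  simp only [lab12, lab21, lab13, lab31, lab14, lab41, lab23, lab32, lab24, lab42, lab34, lab43] <;>
  simp [pr, sub_eq_iff_eq_add]

theorem cuspFib_none (k : ℕ) :
    cuspFib k none = {x | ∃ i : ZMod k, x = (i, pr 1 2) ∨ x = (i, pr 2 1)} := by
  ext ⟨j, p⟩
  change cuspLabel k (j, p) = _ ↔ _
  rcases nodeBranch_cases p with
    rfl | rfl | rfl | rfl | rfl | rfl | rfl | rfl | rfl | rfl | rfl | rfl <;>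
  simp only [lab12, lab21, lab13, lab31, lab14, lab41, lab23, lab32, lab24, lab42, lab34, lab43] <;>
  simp [pr]

/-- For `k ≥ 1` tiles of type `D` glued in a circle, the equivalence classes of the
equivalence relation generated by the node, in-tile and circle gluing relations are
exactly the `2k + 1` sets listed: for each `i` the 2-element set
`{(i,(3,4)), (i,(4,3))}`, for each `i` the 8-element set
`{(i+1,(1,3)), (i+1,(3,1)), (i+1,(4,1)), (i+1,(1,4)), (i,(2,4)), (i,(4,2)), (i,(3,2)), (i,(2,3))}`,
and the `2k`-element set `{(i,(1,2)), (i,(2,1)) : i ∈ ZMod k}`. -/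
theorem stmt2 (k : ℕ) (hk : 1 ≤ k) :
    (Relation.EqvGen.setoid (CircleDGen k)).classes =
      (Set.range fun i : ZMod k =>
        ({(i, pr 3 4), (i, pr 4 3)} : Set (ZMod k × NodeBranch))) ∪
      (Set.range fun i : ZMod k =>
        ({(i + 1, pr 1 3), (i + 1, pr 3 1), (i + 1, pr 4 1), (i + 1, pr 1 4),
          (i, pr 2 4), (i, pr 4 2), (i, pr 3 2), (i, pr 2 3)} : Set (ZMod k × NodeBranch))) ∪
      {{x : ZMod k × NodeBranch | ∃ i : ZMod k, x = (i, pr 1 2) ∨ x = (i, pr 2 1)}} ∧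
    (Relation.EqvGen.setoid (CircleDGen k)).classes.ncard = 2 * k + 1 := by
  rw [classes_eq k hk]
  constructor
  · simp only [← cuspFib_inl, ← cuspFib_inr, ← cuspFib_none]
    ext s
    constructor
    · rintro ⟨_ | i | i, rfl⟩
      · exact Or.inr rfl
      · exact Or.inl (Or.inl ⟨i, rfl⟩)
      · exact Or.inl (Or.inr ⟨i, rfl⟩)
    · rintro ((⟨i, rfl⟩ | ⟨i, rfl⟩) | h)
      · exact ⟨_, rfl⟩
      · exact ⟨_, rfl⟩
      · exact ⟨none, h.symm⟩
  · have : NeZero k := ⟨by omega⟩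
    rw [← Set.image_univ, Set.ncard_image_of_injective _ (cuspFib_injective k), Set.ncard_univ,
      Nat.card_eq_fintype_card, Fintype.card_option, Fintype.card_sum, ZMod.card]
    omega
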